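/- For an irreducible finite-state Markov chain, for any nonempty disjoint sets Y, Z ⊆ X and any state x ∉ Y ∪ Z, the probability of hitting Y before Z satisfies P_x(τ_Y < τ_Z) = P_x(τ_Y < τ_{Z∪{x}}) / P_x(τ_{Y∪Z} ≤ τ_x) ≤ P_x(τ_Y < τ_x) / P_x(τ_Z < τ_x). -/

import Mathlib

open Filter Topology
open scoped Classical

/-- Probability weight of the path `x :: l` for the transition matrix `P`. -/
def pathWeight {S : Type*} (P : S → S → ℝ) : S → List S → ℝ
  | _, [] => 1
  | x, y :: l => P x y * pathWeight P y l

/-- `P` is a stochastic matrix. -/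
def IsStoch {S : Type*} [Fintype S] (P : S → S → ℝ) : Prop :=
  (∀ x y, 0 ≤ P x y) ∧ ∀ x, ∑ y, P x y = 1

/-- Irreducibility of a transition matrix. -/
def Irred {S : Type*} (P : S → S → ℝ) : Prop :=
  ∀ x y : S, ∃ l : List S,
    0 < pathWeight P x l ∧ (x :: l).getLast (List.cons_ne_nil x l) = y

/-- The (nonempty) trajectory `l` ends in `Y` and avoids `Y ∪ Z` before its last step. -/
def HitsIn {S : Type*} (Y Z : Set S) (l : List S) : Prop :=
  (∃ y ∈ Y, l.getLast? = some y) ∧ ∀ a ∈ l.dropLast, a ∉ Y ∪ Z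

/-- `P_x(τ_Y < τ_Z)`: probability, starting from `x`, to hit `Y` strictly before `Z`. -/
noncomputable def hitProb {S : Type*} (P : S → S → ℝ) (x : S) (Y Z : Set S) : ℝ :=
  ∑' l : List S, if HitsIn Y Z l then pathWeight P x l else 0

/-- `E_x[τ_A]`: mean hitting time of `A` starting from `x`. -/
noncomputable def meanHit {S : Type*} (P : S → S → ℝ) (x : S) (A : Set S) : ℝ :=
  ∑' l : List S, if HitsIn A ∅ l then (l.length : ℝ) * pathWeight P x l else 0

/-- Dirichlet form of the pair `(μ, P)`. -/
noncomputable def dirForm {S : Type*} [Fintype S] (μ : S → ℝ) (P : S → S → ℝ)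
    (f : S → ℝ) : ℝ :=
  (1/2) * ∑ y, ∑ z, μ y * P y z * (f y - f z)^2

/-- Capacity between two sets, as the minimum of the Dirichlet form. -/
noncomputable def capacity {S : Type*} [Fintype S] (μ : S → ℝ) (P : S → S → ℝ)
    (Y Z : Set S) : ℝ :=
  sInf ((fun f => dirForm μ P f) ''
    {f : S → ℝ | (∀ x, f x ∈ Set.Icc (0:ℝ) 1) ∧ (∀ y ∈ Y, f y = 1) ∧ (∀ z ∈ Z, f z = 0)})

section Renewal

variable {S : Type*}

/-- The contribution of the trajectory `l` to `hitProb P x A B`. -/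
noncomputable def hitWeight (P : S → S → ℝ) (x : S) (A B : Set S) (l : List S) : ℝ :=
  if HitsIn A B l then pathWeight P x l else 0

theorem not_hitsIn_nil (A B : Set S) : ¬ HitsIn A B [] := by
  simp [HitsIn]

theorem hitsIn_singleton (A B : Set S) (y : S) : HitsIn A B [y] ↔ y ∈ A := by
  simp [HitsIn]

theorem hitsIn_cons_of_ne_nil (A B : Set S) (y : S) {l : List S} (hl : l ≠ []) :
    HitsIn A B (y :: l) ↔ y ∉ A ∪ B ∧ HitsIn A B l := by
  obtain ⟨z, t, rfl⟩ := List.exists_cons_of_ne_nil hl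
  simp only [HitsIn, List.getLast?_cons_cons, List.dropLast_cons_cons, List.forall_mem_cons]
  tauto

theorem HitsIn.mono_right {A B C : Set S} (hBC : B ⊆ C) {l : List S} (h : HitsIn A C l) :
    HitsIn A B l :=
  ⟨h.1, fun a ha hab => h.2 a ha (Set.union_subset_union_right A hBC hab)⟩

theorem pathWeight_nonneg {P : S → S → ℝ} (hP : ∀ x y, 0 ≤ P x y) (x : S) (l : List S) :
    0 ≤ pathWeight P x l := by
  induction l generalizing x with
  | nil => exact zero_le_one
  | cons y l ih => exact mul_nonneg (hP x y) (ih y)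

theorem hitWeight_nonneg {P : S → S → ℝ} (hP : ∀ x y, 0 ≤ P x y) (x : S) (A B : Set S)
    (l : List S) : 0 ≤ hitWeight P x A B l := by
  unfold hitWeight
  split_ifs
  exacts [pathWeight_nonneg hP x l, le_rfl]

theorem hitWeight_nil (P : S → S → ℝ) (x : S) (A B : Set S) : hitWeight P x A B [] = 0 :=
  if_neg (not_hitsIn_nil A B)

theorem hitWeight_cons (P : S → S → ℝ) (x y : S) (A B : Set S) (l : List S) :
    hitWeight P x A B (y :: l) = P x y *
      (if y ∈ A then (if l = [] then 1 else 0) else if y ∈ B then 0 else hitWeight P y A B l) := by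
  rcases eq_or_ne l [] with rfl | hl
  · simp [hitWeight, hitsIn_singleton, not_hitsIn_nil, pathWeight]
  · by_cases hA : y ∈ A <;> by_cases hB : y ∈ B <;>
      simp [hitWeight, hitsIn_cons_of_ne_nil A B y hl, hl, hA, hB, pathWeight]

theorem sum_list_le_sum_cons [Fintype S] {F : List S → ℝ} (hF : ∀ l, 0 ≤ F l) (h0 : F [] = 0)
    (s : Finset (List S)) :
    ∑ l ∈ s, F l ≤ ∑ y, ∑ l ∈ s.image List.tail, F (y :: l) := by
  have hinj : Set.InjOn (fun p : S × List S => p.1 :: p.2)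
      (Finset.univ ×ˢ s.image List.tail : Finset (S × List S)) := by
    rintro ⟨a, l⟩ - ⟨b, m⟩ - h
    simpa using h
  rw [← Finset.sum_product' (f := fun y l => F (y :: l)), ← Finset.sum_image (f := F) hinj,
    ← Finset.sum_erase s h0]
  refine Finset.sum_le_sum_of_subset_of_nonneg (fun l hl => ?_) fun l _ _ => hF l
  obtain ⟨hne, hls⟩ := Finset.mem_erase.1 hl
  obtain ⟨y, t, rfl⟩ := List.exists_cons_of_ne_nil hne
  exact Finset.mem_image.2 ⟨(y, t), Finset.mem_product.2
    ⟨Finset.mem_univ y, Finset.mem_image.2 ⟨_, hls, rfl⟩⟩, rfl⟩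

theorem sum_hitWeight_le_one [Fintype S] {P : S → S → ℝ} (hP : IsStoch P) (A B : Set S) (n : ℕ)
    (x : S) (s : Finset (List S)) (hs : ∀ l ∈ s, l.length ≤ n) :
    ∑ l ∈ s, hitWeight P x A B l ≤ 1 := by
  induction n generalizing x s with
  | zero =>
    refine (Finset.sum_nonpos fun l hl => ?_).trans zero_le_one
    rw [List.length_eq_zero_iff.1 (Nat.le_zero.1 (hs l hl)), hitWeight_nil]
  | succ n ih =>
    refine (sum_list_le_sum_cons (hitWeight_nonneg hP.1 x A B) (hitWeight_nil P x A B) s).trans ?_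
    rw [← hP.2 x]
    refine Finset.sum_le_sum fun y _ => ?_
    simp only [hitWeight_cons]
    rw [← Finset.mul_sum]
    refine mul_le_of_le_one_right (hP.1 x y) ?_
    split_ifs
    · rw [Finset.sum_ite_eq']
      split_ifs <;> norm_num
    · simp
    · refine ih y _ fun l hl => ?_
      obtain ⟨m, hm, rfl⟩ := Finset.mem_image.1 hl
      have := hs m hm
      rw [List.length_tail]
      omega

theorem summable_hitWeight [Fintype S] {P : S → S → ℝ} (hP : IsStoch P) (x : S) (A B : Set S) :
    Summable (hitWeight P x A B) :=
  summable_of_sum_le (hitWeight_nonneg hP.1 x A B) fun s =>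
    sum_hitWeight_le_one hP A B (s.sup List.length) x s fun _ hl => Finset.le_sup hl

/-- First-step decomposition of hitting probabilities. -/
theorem hitProb_eq_sum [Fintype S] {P : S → S → ℝ} (hP : IsStoch P) (x : S) (A B : Set S) :
    hitProb P x A B =
      ∑ y, P x y * (if y ∈ A then 1 else if y ∈ B then 0 else hitProb P y A B) := by
  have hinj : Function.Injective (fun p : S × List S => p.1 :: p.2) := by
    rintro ⟨a, l⟩ ⟨b, m⟩ h
    simpa using h
  have hsupp : Function.support (hitWeight P x A B) ⊆
      Set.range (fun p : S × List S => p.1 :: p.2) := by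
    rintro (_ | ⟨y, l⟩) hl
    · exact absurd (hitWeight_nil P x A B) hl
    · exact ⟨(y, l), rfl⟩
  change ∑' l, hitWeight P x A B l = _
  rw [← hinj.tsum_eq hsupp,
    Summable.tsum_prod (f := fun p : S × List S => hitWeight P x A B (p.1 :: p.2))
      ((summable_hitWeight hP x A B).comp_injective hinj), tsum_fintype]
  refine Finset.sum_congr rfl fun y _ => ?_
  simp only [hitWeight_cons, tsum_mul_left]
  congr 1
  split_ifs
  · exact tsum_ite_eq _ _
  · exact tsum_zero
  · rfl

theorem hitProb_nonneg {P : S → S → ℝ} (hP : ∀ x y, 0 ≤ P x y) (x : S) (A B : Set S) :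
    0 ≤ hitProb P x A B :=
  tsum_nonneg (hitWeight_nonneg hP x A B)

theorem hitProb_anti_right [Fintype S] {P : S → S → ℝ} (hP : IsStoch P) (x : S) {A B C : Set S}
    (hBC : B ⊆ C) : hitProb P x A C ≤ hitProb P x A B := by
  refine Summable.tsum_le_tsum (fun l => ?_) (summable_hitWeight hP x A C)
    (summable_hitWeight hP x A B)
  by_cases h : HitsIn A C l
  · rw [if_pos h, if_pos (h.mono_right hBC)]
  · rw [if_neg h]
    exact hitWeight_nonneg hP.1 x A B l

/-- A set closed under transitions of positive probability contains the endpoints of all paths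
of positive weight started in it. -/
theorem getLast_mem_of_pathWeight_pos {P : S → S → ℝ} (hP : ∀ x y, 0 ≤ P x y) {K : Set S}
    (hK : ∀ a ∈ K, ∀ b, 0 < P a b → b ∈ K) {a : S} (ha : a ∈ K) {l : List S}
    (hl : 0 < pathWeight P a l) : (a :: l).getLast (List.cons_ne_nil a l) ∈ K := by
  induction l generalizing a with
  | nil => exact ha
  | cons b l ih =>
    have hab : 0 < P a b := pos_of_mul_pos_left hl (pathWeight_nonneg hP b l)
    rw [List.getLast_cons_cons]
    exact ih (hK a ha b hab) (pos_of_mul_pos_right hl (hP a b))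

/-- Uniqueness for the homogeneous Dirichlet problem with boundary `T`. -/
theorem eq_zero_of_eq_sum [Fintype S] {P : S → S → ℝ} (hP : IsStoch P) (hirr : Irred P)
    {T : Set S} (hT : T.Nonempty) {d : S → ℝ}
    (hd : ∀ x, d x = ∑ y, P x y * (if y ∈ T then 0 else d y)) (x : S) : d x = 0 := by
  have : Nonempty S := ⟨x⟩
  obtain ⟨a, ha⟩ := Finite.exists_max fun y => |d y|
  by_contra hx
  have hpos : 0 < |d a| := (abs_pos.2 hx).trans_le (ha x)
  have key : ∀ b, |d b| = |d a| → ∀ c, 0 < P b c → c ∉ T ∧ |d c| = |d a| := by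
    intro b hb c hc
    have hle : ∀ y, |if y ∈ T then 0 else d y| ≤ |d a| := fun y => by
      split_ifs
      · simp
      · exact ha y
    have hsum : |d a| ≤ ∑ y, P b y * |if y ∈ T then 0 else d y| := by
      rw [← hb, hd b]
      refine (Finset.abs_sum_le_sum_abs _ _).trans_eq (Finset.sum_congr rfl fun y _ => ?_)
      rw [abs_mul, abs_of_nonneg (hP.1 b y)]
    have hc' : |d a| ≤ |if c ∈ T then 0 else d c| := by
      by_contra! hlt
      have : ∑ y, P b y * |if y ∈ T then 0 else d y| < ∑ y, P b y * |d a| :=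
        Finset.sum_lt_sum (fun y _ => mul_le_mul_of_nonneg_left (hle y) (hP.1 b y))
          ⟨c, Finset.mem_univ c, mul_lt_mul_of_pos_left hlt hc⟩
      rw [← Finset.sum_mul, hP.2 b, one_mul] at this
      linarith
    split_ifs at hc' with hcT
    · simp only [abs_zero] at hc'
      linarith
    · exact ⟨hcT, (ha c).antisymm hc'⟩
  obtain ⟨c, hc⟩ : ∃ c, 0 < P a c := by
    by_contra! h
    have := Finset.sum_nonpos fun y (_ : y ∈ Finset.univ) => h y
    linarith [hP.2 a]
  obtain ⟨t, ht⟩ := hT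
  obtain ⟨l, hl, rfl⟩ := hirr c t
  exact (getLast_mem_of_pathWeight_pos hP.1 (K := {b | b ∉ T ∧ |d b| = |d a|})
    (fun b hb => key b hb.2) (key a rfl c hc) hl).1 ht

/-- Almost surely one of two disjoint sets is hit before the other. -/
theorem hitProb_add_hitProb [Fintype S] {P : S → S → ℝ} (hP : IsStoch P) (hirr : Irred P)
    {A B : Set S} (hA : A.Nonempty) (hAB : Disjoint A B) (x : S) :
    hitProb P x A B + hitProb P x B A = 1 := by
  have h := eq_zero_of_eq_sum hP hirr (T := A ∪ B) (hA.inl)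
    (d := fun x => hitProb P x A B + hitProb P x B A - 1) (fun x => ?_) x
  · exact sub_eq_zero.1 h
  · nth_rewrite 1 [← hP.2 x]
    rw [hitProb_eq_sum hP x A B, hitProb_eq_sum hP x B A, ← Finset.sum_add_distrib,
      ← Finset.sum_sub_distrib]
    refine Finset.sum_congr rfl fun y _ => ?_
    have hdis : y ∈ A → y ∉ B := fun h => Set.disjoint_left.1 hAB h
    by_cases h1 : y ∈ A <;> by_cases h2 : y ∈ B <;> simp_all
    ring

/-- Splitting according to whether the chain visits `x` before hitting `Y ∪ Z`. -/
theorem hitProb_eq_add_mul [Fintype S] {P : S → S → ℝ} (hP : IsStoch P) (hirr : Irred P)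
    {Y Z : Set S} {x : S} (hx : x ∉ Y ∪ Z) (y : S) :
    hitProb P y Y Z =
      hitProb P y Y (Z ∪ {x}) + hitProb P y {x} (Y ∪ Z) * hitProb P x Y Z := by
  have h := eq_zero_of_eq_sum hP hirr (T := Y ∪ Z ∪ {x}) ⟨x, Or.inr rfl⟩
    (d := fun y => hitProb P y Y Z -
      (hitProb P y Y (Z ∪ {x}) + hitProb P y {x} (Y ∪ Z) * hitProb P x Y Z)) (fun y => ?_) y
  · exact sub_eq_zero.1 h
  · generalize hc : hitProb P x Y Z = c
    rw [hitProb_eq_sum hP y Y Z, hitProb_eq_sum hP y Y (Z ∪ {x}),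
      hitProb_eq_sum hP y {x} (Y ∪ Z), Finset.sum_mul, ← Finset.sum_add_distrib,
      ← Finset.sum_sub_distrib]
    refine Finset.sum_congr rfl fun w _ => ?_
    obtain ⟨hxY, hxZ⟩ : x ∉ Y ∧ x ∉ Z := not_or.1 hx
    by_cases hwx : w = x
    · subst hwx
      simp [hxY, hxZ, hc]
    · by_cases h1 : w ∈ Y <;> by_cases h2 : w ∈ Z <;> simp [h1, h2, hwx]
      ring

theorem pathWeight_append_cons (P : S → S → ℝ) (x y : S) (l m : List S) :
    pathWeight P x (l ++ y :: m) = pathWeight P x (l ++ [y]) * pathWeight P y m := by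
  induction l generalizing x with
  | nil => simp [pathWeight]
  | cons z l ih => simp [pathWeight, ih, mul_assoc]

theorem hitProb_singleton_pos [Fintype S] {P : S → S → ℝ} (hP : IsStoch P) (hirr : Irred P)
    {Z : Set S} (hZ : Z.Nonempty) {x : S} (hx : x ∉ Z) : 0 < hitProb P x Z {x} := by
  have hex : ∃ n, ∃ l : List S, l.length = n ∧ 0 < pathWeight P x l ∧
      ∃ z ∈ Z, l.getLast? = some z := by
    obtain ⟨z, hz⟩ := hZ
    obtain ⟨l, hl, hlast⟩ := hirr x z
    refine ⟨_, l, rfl, hl, z, hz, ?_⟩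
    rcases eq_or_ne l [] with rfl | hne
    · exact absurd hz (hlast ▸ hx)
    · rw [List.getLast_cons hne] at hlast
      rw [List.getLast?_eq_some_getLast hne, hlast]
  obtain ⟨l, hlen, hpos, z, hz, hlast⟩ := Nat.find_spec hex
  have hhit : HitsIn Z {x} l := by
    refine ⟨⟨z, hz, hlast⟩, fun a ha hmem => ?_⟩
    have hne : l ≠ [] := by
      rintro rfl
      simp at hlast
    obtain ⟨s, t, hst⟩ := List.append_of_mem ha
    have hl : l = s ++ a :: (t ++ [z]) := by
      rw [← List.dropLast_append_getLast? z hlast, hst]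
      simp
    rw [hl, pathWeight_append_cons] at hpos
    have hs : 0 < pathWeight P x (s ++ [a]) :=
      pos_of_mul_pos_left hpos (pathWeight_nonneg hP.1 _ _)
    have ht : 0 < pathWeight P a (t ++ [z]) :=
      pos_of_mul_pos_right hpos (pathWeight_nonneg hP.1 _ _)
    have hlen' : s.length + (t.length + 1 + 1) = Nat.find hex := by
      rw [← hlen, hl]
      simp
    rcases hmem with haZ | rfl
    · exact Nat.find_min hex (m := s.length + 1) (by omega)
        ⟨s ++ [a], by simp, hs, a, haZ, by simp⟩
    · exact Nat.find_min hex (m := t.length + 1) (by omega)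
        ⟨t ++ [z], by simp, ht, z, hz, by simp⟩
  refine (summable_hitWeight hP x Z {x}).tsum_pos (hitWeight_nonneg hP.1 x Z {x}) l ?_
  rwa [hitWeight, if_pos hhit]

end Renewal

/-- Renewal identity and bound for hitting probabilities:
`P_x(τ_Y < τ_Z) = P_x(τ_Y < τ_{Z∪{x}}) / P_x(τ_{Y∪Z} ≤ τ_x) ≤ P_x(τ_Y<τ_x)/P_x(τ_Z<τ_x)`. -/
theorem hitProb_renewal {S : Type*} [Fintype S]
    (P : S → S → ℝ) (hP : IsStoch P) (hirr : Irred P)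
    (Y Z : Set S) (hY : Y.Nonempty) (hZ : Z.Nonempty) (hYZ : Disjoint Y Z)
    (x : S) (hx : x ∉ Y ∪ Z) :
    hitProb P x Y Z = hitProb P x Y (Z ∪ {x}) / hitProb P x (Y ∪ Z) {x} ∧
    hitProb P x Y Z ≤ hitProb P x Y {x} / hitProb P x Z {x} := by
  have hxZ : x ∉ Z := fun h => hx (Or.inr h)
  have hpos := hitProb_singleton_pos hP hirr hZ hxZ
  have hposYZ := hitProb_singleton_pos hP hirr hY.inl hx
  have hsumZ := hitProb_add_hitProb hP hirr hZ (Set.disjoint_singleton_right.2 hxZ) x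
  have hsumYZ := hitProb_add_hitProb hP hirr hY.inl (Set.disjoint_singleton_right.2 hx) x
  have hanti := hitProb_anti_right hP x (A := {x}) (Set.subset_union_right : Z ⊆ Y ∪ Z)
  have heq : hitProb P x Y Z = hitProb P x Y (Z ∪ {x}) / hitProb P x (Y ∪ Z) {x} := by
    rw [eq_div_iff hposYZ.ne', eq_sub_of_add_eq hsumYZ]
    linear_combination hitProb_eq_add_mul hP hirr hx x
  refine ⟨heq, heq.trans_le ?_⟩
  exact div_le_div₀ (hitProb_nonneg hP.1 x Y {x})
    (hitProb_anti_right hP x Set.subset_union_right) hpos (by linarith)
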